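/- Let Λ be a ring with Jacobson radical r, (e, f) complementary idempotents with fΛe ⊆ r, and Λ* = fΛf. Suppose 0 → P^n → ⋯ → P^1 → P^0 → (Λ/r)e → 0 is a finite projective Λ-resolution of (Λ/r)e such that P^0 ≅ Λe and each P^i for i ≥ 1 is a direct sum of projective modules of the form Λw with w an idempotent satisfying fw = w (i.e. belonging to f). Then fΛe has finite projective dimension as a left Λ*-module (in fact pd_{Λ*}(fΛe) ≤ n − 1). -/

import Mathlib

/-! STATEMENT 18: Let `r = J(Λ)`, `(e, f)` complementary idempotents with `fΛe ⊆ r`,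
and `Λ* = fΛf`.  Suppose `0 → Pⁿ → ⋯ → P¹ → P⁰ → (Λ/r)e → 0` is a projective
`Λ`-resolution with `P⁰ ≅ Λe` and each `Pⁱ` (`i ≥ 1`) a direct sum of modules `Λw`
with `w` an idempotent belonging to `f` (`fw = w`).  Then `pd_{Λ*}(fΛe) ≤ n - 1`
(encoded by vanishing of `Ext^k_{Λ*}(fΛe, -)` for `k > n - 1`). -/

universe u

section CornerLib

variable {Λ : Type u} [Ring Λ]

/-- The set `{x | f * x * f = x}`, i.e. the corner `fΛf`, as an additive subgroup. -/
def cornerAddSubgroup (f : Λ) : AddSubgroup Λ where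
  carrier := {x | f * x * f = x}
  add_mem' := by
    intro a b ha hb
    simp only [Set.mem_setOf_eq] at *
    rw [mul_add, add_mul, ha, hb]
  zero_mem' := by simp
  neg_mem' := by
    intro a ha
    simp only [Set.mem_setOf_eq] at *
    rw [mul_neg, neg_mul, ha]

/-- The corner ring `fΛf`. -/
def Corner (f : Λ) : Type u := ↥(cornerAddSubgroup f)

instance (e : Λ) [he : Fact (IsIdempotentElem e)] : Fact (IsIdempotentElem (1 - e)) :=
  ⟨he.out.one_sub⟩

namespace Corner

variable {f : Λ} [hf : Fact (IsIdempotentElem f)]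

instance : AddCommGroup (Corner f) :=
  inferInstanceAs (AddCommGroup ↥(cornerAddSubgroup f))

theorem absorb_left {x : Λ} (hx : f * x * f = x) : f * x = x := by
  conv_lhs => rw [← hx]
  rw [← mul_assoc, ← mul_assoc, hf.out]
  exact hx

theorem absorb_right {x : Λ} (hx : f * x * f = x) : x * f = x := by
  conv_lhs => rw [← hx]
  rw [mul_assoc, mul_assoc, hf.out]
  rw [← mul_assoc]
  exact hx

theorem mul_mem' {x y : Λ} (hx : f * x * f = x) (hy : f * y * f = y) :
    f * (x * y) * f = x * y := by
  rw [← mul_assoc f x y, absorb_left hx, mul_assoc, absorb_right hy]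

instance : Ring (Corner f) :=
  { (inferInstance : AddCommGroup (Corner f)) with
    mul := fun x y => ⟨x.1 * y.1, mul_mem' x.2 y.2⟩
    one := ⟨f, by show f * f * f = f; rw [hf.out, hf.out]⟩
    mul_assoc := fun a b c => Subtype.ext (mul_assoc a.1 b.1 c.1)
    one_mul := fun a => Subtype.ext (absorb_left a.2)
    mul_one := fun a => Subtype.ext (absorb_right a.2)
    left_distrib := fun a b c => Subtype.ext (mul_add a.1 b.1 c.1)
    right_distrib := fun a b c => Subtype.ext (add_mul a.1 b.1 c.1)
    zero_mul := fun a => Subtype.ext (zero_mul a.1)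
    mul_zero := fun a => Subtype.ext (mul_zero a.1) }

@[simp] theorem mul_val (x y : Corner f) : (x * y).1 = x.1 * y.1 := rfl
@[simp] theorem one_val : (1 : Corner f).1 = f := rfl

end Corner

/-- For a left `Λ`-module `M`, the subgroup `fM = {m | f • m = m}`. -/
def cornerSubAddSubgroup (f : Λ) (M : Type u) [AddCommGroup M] [Module Λ M] :
    AddSubgroup M where
  carrier := {m | f • m = m}
  add_mem' := by
    intro a b ha hb
    simp only [Set.mem_setOf_eq] at *
    rw [smul_add, ha, hb]
  zero_mem' := by simp
  neg_mem' := by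
    intro a ha
    simp only [Set.mem_setOf_eq] at *
    rw [smul_neg, ha]

/-- `fM`, the image of a left `Λ`-module `M` under the idempotent `f`;
this is the concrete incarnation of `fΛ ⊗_Λ M`. -/
def CornerSub (f : Λ) (M : Type u) [AddCommGroup M] [Module Λ M] : Type u :=
  ↥(cornerSubAddSubgroup f M)

namespace CornerSub

variable {f : Λ} [hf : Fact (IsIdempotentElem f)]
variable {M : Type u} [AddCommGroup M] [Module Λ M]

instance : AddCommGroup (CornerSub f M) :=
  inferInstanceAs (AddCommGroup ↥(cornerSubAddSubgroup f M))

instance : SMul (Corner f) (CornerSub f M) :=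
  ⟨fun a m => ⟨a.1 • m.1, by
    show f • a.1 • m.1 = a.1 • m.1
    rw [smul_smul, Corner.absorb_left a.2]⟩⟩

@[simp] theorem smul_val (a : Corner f) (m : CornerSub f M) :
    (a • m).1 = a.1 • m.1 := rfl

instance : Module (Corner f) (CornerSub f M) where
  one_smul m := Subtype.ext m.2
  mul_smul a b m := Subtype.ext (mul_smul a.1 b.1 m.1)
  smul_add a m n := Subtype.ext (smul_add a.1 m.1 n.1)
  add_smul a b m := Subtype.ext (add_smul a.1 b.1 m.1)
  zero_smul m := Subtype.ext (zero_smul Λ m.1)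
  smul_zero a := Subtype.ext (smul_zero a.1)

end CornerSub

/-- The functorial action of `M ↦ fM` on a `Λ`-linear map. -/
def cornerMap (f : Λ) [hf : Fact (IsIdempotentElem f)]
    {M N : Type u} [AddCommGroup M] [Module Λ M] [AddCommGroup N] [Module Λ N]
    (g : M →ₗ[Λ] N) : CornerSub f M →ₗ[Corner f] CornerSub f N where
  toFun m := ⟨g m.1, by show f • g m.1 = g m.1; rw [← map_smul, m.2]⟩
  map_add' m n := Subtype.ext (map_add g m.1 n.1)
  map_smul' a m := Subtype.ext (map_smul g a.1 m.1)

/-- The left ideal `Λe`. -/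
def lambdaE (e : Λ) : Submodule Λ Λ :=
  LinearMap.range (LinearMap.toSpanSingleton Λ Λ e)

/-- The Jacobson radical of a ring. -/
def jacRad (Λ : Type u) [Ring Λ] : Ideal Λ := Ideal.jacobson (⊥ : Ideal Λ)

end CornerLib

open CategoryTheory DirectSum

/-- `(Λ/r)ε`, the image of `Λε` in `Λ/r`, as an object of `ModuleCat Λ`. -/
def radQuotPart (Λ : Type u) [Ring Λ] (ε : Λ) : ModuleCat.{u} Λ :=
  ModuleCat.of Λ ↥(Submodule.map (jacRad Λ).mkQ (lambdaE ε))

theorem cornerSub_ext {Λ : Type u} [Ring Λ] {f : Λ} {M : Type u} [AddCommGroup M] [Module Λ M]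
    {x y : CornerSub f M} (h : x.1 = y.1) : x = y := Subtype.ext h

theorem mem_lambdaE {Λ : Type u} [Ring Λ] {w x : Λ} (h : x ∈ lambdaE w) : ∃ a, x = a * w := by
  obtain ⟨a, ha⟩ := h
  exact ⟨a, by simpa using ha.symm⟩

theorem pd_aux {R : Type u} [Ring R] (m : ℕ) : ∀ (Q : ℕ → ModuleCat.{u} R) (X : ModuleCat.{u} R)
    (_ : ∀ i, Module.Projective R (Q i)) (_ : ∀ i, m < i → Subsingleton (Q i : Type u))
    (δ : ∀ i, (Q (i + 1) : Type u) →ₗ[R] (Q i : Type u)) (p : (Q 0 : Type u) →ₗ[R] (X : Type u))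
    (_ : Function.Surjective p) (_ : LinearMap.range (δ 0) = LinearMap.ker p)
    (_ : ∀ i, LinearMap.range (δ (i + 1)) = LinearMap.ker (δ i)),
    HasProjectiveDimensionLT X (m + 1) := by
  induction m with
  | zero =>
    intro Q X hP hz δ p hs h0 _
    have hinj : Function.Injective p := by
      rw [← LinearMap.ker_eq_bot, ← h0, LinearMap.range_eq_bot]
      have := hz 1 (by omega)
      ext x
      have hx : x = 0 := Subsingleton.elim (α := (Q 1 : Type u)) _ _
      rw [hx]; simp
    have hP0 := hP 0
    have : Projective (Q 0) := (IsProjective.iff_projective (R := R) (Q 0 : Type u)).1 hP0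
    exact hasProjectiveDimensionLT_of_iso
      (LinearEquiv.toModuleIso (X₁ := Q 0) (X₂ := X) (LinearEquiv.ofBijective p ⟨hinj, hs⟩)) 1
  | succ m ih =>
    intro Q X hP hz δ p hs h0 h
    have hP0 := hP 0
    have hQ0 : Projective (Q 0) := (IsProjective.iff_projective (R := R) (Q 0 : Type u)).1 hP0
    have hK : HasProjectiveDimensionLT (ModuleCat.of R (LinearMap.ker p)) (m + 1) := by
      refine ih (fun i => Q (i + 1)) _ (fun i => hP _) (fun i hi => hz _ (by omega))
        (fun i => δ (i + 1))
        (LinearMap.codRestrict (LinearMap.ker p) (δ 0) (fun x => h0 ▸ LinearMap.mem_range_self _ x))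
        ?_ ?_ (fun i => h _)
      · rintro ⟨y, hy⟩
        rw [← h0] at hy
        obtain ⟨x, rfl⟩ := hy
        exact ⟨x, rfl⟩
      · rw [LinearMap.ker_codRestrict]; exact h 0
    have hS := LinearMap.shortExact_shortComplexKer hs
    have hQ2 : HasProjectiveDimensionLT (Q 0) (m + 1 + 1) :=
      hasProjectiveDimensionLT_of_ge _ 1 _ (by omega)
    exact hS.hasProjectiveDimensionLT_X₃ (m + 1) hK hQ2

section
variable {Λ : Type u} [Ring Λ] (f : Λ) [hf : Fact (IsIdempotentElem f)]
  {M N L : Type u} [AddCommGroup M] [Module Λ M] [AddCommGroup N] [Module Λ N]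
  [AddCommGroup L] [Module Λ L]

theorem cornerMap_exact (g : M →ₗ[Λ] N) (h : N →ₗ[Λ] L)
    (H : LinearMap.range g = LinearMap.ker h) :
    LinearMap.range (cornerMap f g) = LinearMap.ker (cornerMap f h) := by
  ext y
  constructor
  · rintro ⟨x, rfl⟩
    have : g x.1 ∈ LinearMap.ker h := H ▸ LinearMap.mem_range_self g x.1
    exact cornerSub_ext this
  · intro hy
    have hy' : h y.1 = 0 := congrArg Subtype.val hy
    have : y.1 ∈ LinearMap.range g := H ▸ hy'
    obtain ⟨x, hx⟩ := this
    refine ⟨⟨f • x, ?_⟩, cornerSub_ext ?_⟩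
    · show f • f • x = f • x
      rw [smul_smul, hf.out]
    · show g (f • x) = y.1
      rw [map_smul, hx]; exact y.2

theorem cornerSub_projective {ι : Type u} (w : ι → Λ)
    (hw : ∀ j, IsIdempotentElem (w j) ∧ f * w j = w j)
    (φ : M ≃ₗ[Λ] (⨁ j : ι, ↥(lambdaE (w j)))) :
    Module.Projective (Corner f) (CornerSub f M) := by
  classical
  have hff : f * f = f := hf.out
  let c : Λ →+ Corner f :=
    { toFun := fun x => ⟨f * x * f, by
        show f * (f * x * f) * f = f * x * f
        simp only [← mul_assoc, hff]
        rw [mul_assoc (f * x), hff]⟩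
      map_zero' := Subtype.ext (by show f * 0 * f = 0; simp)
      map_add' := fun x y => Subtype.ext (by
        show f * (x + y) * f = f * x * f + f * y * f
        rw [mul_add, add_mul]) }
  have hc : ∀ x, (c x).1 = f * x * f := fun x => rfl
  let S : (⨁ j : ι, ↥(lambdaE (w j))) →+ (⨁ _j : ι, Corner f) :=
    DFinsupp.mapRange.addMonoidHom (fun j => c.comp (lambdaE (w j)).subtype.toAddMonoidHom)
  have hS : ∀ x j, (S x) j = c (x j).1 := fun x j => rfl
  let s : CornerSub f M →ₗ[Corner f] (⨁ _j : ι, Corner f) :=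
    { toFun := fun m => S (φ m.1)
      map_add' := fun m m' => by
        show S (φ (m.1 + m'.1)) = _
        rw [map_add, map_add]
      map_smul' := fun a m => by
        show S (φ (a.1 • m.1)) = a • S (φ m.1)
        refine DFinsupp.ext fun j => ?_
        rw [map_smul]
        refine Subtype.ext ?_
        show f * (a.1 * ((φ m.1) j).1) * f = a.1 * (f * ((φ m.1) j).1 * f)
        have h1 : f * a.1 = a.1 := Corner.absorb_left a.2
        have h2 : a.1 * f = a.1 := Corner.absorb_right a.2
        simp only [← mul_assoc, h1, h2] }
  let v : ∀ j, CornerSub f M := fun j =>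
    ⟨φ.symm (DirectSum.lof Λ ι (fun j => ↥(lambdaE (w j))) j ⟨w j, ⟨1, by simp⟩⟩), by
      show f • φ.symm _ = φ.symm _
      rw [← map_smul, ← map_smul]
      congr 2
      exact Subtype.ext (hw j).2⟩
  let p : (⨁ _j : ι, Corner f) →ₗ[Corner f] CornerSub f M :=
    DirectSum.toModule (Corner f) ι _ (fun j => LinearMap.toSpanSingleton _ _ (v j))
  have key : ∀ x : (⨁ j : ι, ↥(lambdaE (w j))), (p (S x)).1 = f • φ.symm x := by
    intro x
    induction x using DirectSum.induction_on with
    | zero =>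
      rw [map_zero, map_zero, map_zero, smul_zero]; rfl
    | of j y =>
      have h1 : S (DirectSum.of (fun j => ↥(lambdaE (w j))) j y)
          = DirectSum.lof (Corner f) ι (fun _ => Corner f) j (c y.1) :=
        DFinsupp.mapRange_single (hf := fun _ => map_zero _)
      rw [h1]
      show (DirectSum.toModule (Corner f) ι _ (fun j => LinearMap.toSpanSingleton _ _ (v j)) _).1 = _
      rw [DirectSum.toModule_lof]
      show (f * y.1 * f) • φ.symm (DirectSum.lof Λ ι (fun j => ↥(lambdaE (w j))) j _) = 
        f • φ.symm (DirectSum.lof Λ ι (fun j => ↥(lambdaE (w j))) j y)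
      rw [← map_smul, ← map_smul, ← map_smul, ← map_smul]
      congr 2
      refine Subtype.ext ?_
      show f * y.1 * f * w j = f * y.1
      obtain ⟨a, ha⟩ := mem_lambdaE y.2
      have hww : w j * w j = w j := (hw j).1
      rw [mul_assoc, (hw j).2, ha, mul_assoc, mul_assoc, hww]
    | add x y hx hy =>
      rw [map_add, map_add, map_add, smul_add, ← hx, ← hy]; rfl
  refine Module.Projective.of_split s p ?_
  refine LinearMap.ext fun m => cornerSub_ext ?_
  show (p (S (φ m.1))).1 = m.1
  rw [key, LinearEquiv.symm_apply_apply]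
  exact m.2

end

theorem corner_pd_finite_of_resolution
    {Λ : Type u} [Ring Λ] (e : Λ) [he : Fact (IsIdempotentElem e)]
    [HasExt.{u} (ModuleCat.{u} (Corner (1 - e)))]
    (hsub : ∀ x : Λ, (1 - e) * x * e ∈ jacRad Λ)
    (n : ℕ)
    (P : ℕ → ModuleCat.{u} Λ)
    -- the resolution is finite, of length `n`
    (hzero : ∀ i, n < i → Subsingleton (P i : Type u))
    (d : ∀ i, (P (i + 1) : Type u) →ₗ[Λ] (P i : Type u))
    (ε : (P 0 : Type u) →ₗ[Λ] (radQuotPart Λ e : Type u))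
    (hsurj : Function.Surjective ε)
    (hex0 : LinearMap.range (d 0) = LinearMap.ker ε)
    (hex : ∀ i, LinearMap.range (d (i + 1)) = LinearMap.ker (d i))
    -- `P⁰ ≅ Λe`
    (hP0 : Nonempty ((P 0 : Type u) ≃ₗ[Λ] ↥(lambdaE e)))
    -- each `Pⁱ`, `i ≥ 1`, is a direct sum of modules `Λw` with `w` idempotent, `fw = w`
    (hPi : ∀ i : ℕ, 1 ≤ i → ∃ (ι : Type u) (w : ι → Λ),
      (∀ j, IsIdempotentElem (w j) ∧ (1 - e) * w j = w j) ∧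
      Nonempty ((P i : Type u) ≃ₗ[Λ] (⨁ j : ι, ↥(lambdaE (w j))))) :
    ∀ (N : ModuleCat.{u} (Corner (1 - e))) (k : ℕ), n - 1 < k →
      Subsingleton (Abelian.Ext
        (ModuleCat.of (Corner (1 - e)) (CornerSub (1 - e) ↥(lambdaE e))) N k) := by
  intro N k hk
  obtain ⟨φ⟩ := hP0
  have hX : HasProjectiveDimensionLT
      (ModuleCat.of (Corner (1 - e)) (CornerSub (1 - e) ↥(lambdaE e))) (n - 1 + 1) := by
    refine pd_aux (n - 1)
      (fun i => ModuleCat.of (Corner (1 - e)) (CornerSub (1 - e) (P (i + 1) : Type u))) _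
      ?_ ?_ (fun i => cornerMap (1 - e) (d (i + 1)))
      (cornerMap (1 - e) (φ.toLinearMap ∘ₗ d 0)) ?_ ?_ ?_
    · intro i
      obtain ⟨ι, w, hw, ⟨ψ⟩⟩ := hPi (i + 1) (by omega)
      exact cornerSub_projective (1 - e) w hw ψ
    · intro i hi
      have := hzero (i + 1) (by omega)
      exact ⟨fun x y => cornerSub_ext (Subsingleton.elim (α := (P (i + 1) : Type u)) _ _)⟩
    · intro y
      have hy : (1 - e) • y.1 = y.1 := y.2
      have h0 : ∀ z : (radQuotPart Λ e : Type u), (1 - e) • z = 0 := by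
        rintro ⟨z, hz⟩
        obtain ⟨x, hx, rfl⟩ := hz
        obtain ⟨a, rfl⟩ := mem_lambdaE hx
        refine Subtype.ext ?_
        show (1 - e) • (jacRad Λ).mkQ (a * e) = 0
        rw [← map_smul, Submodule.mkQ_apply, Submodule.Quotient.mk_eq_zero, smul_eq_mul,
          ← mul_assoc]
        exact hsub a
      have hk : φ.symm y.1 ∈ LinearMap.ker ε := by
        rw [LinearMap.mem_ker, ← hy, map_smul, map_smul, h0]
      rw [← hex0] at hk
      obtain ⟨x, hx⟩ := hk
      refine ⟨⟨(1 - e) • x, ?_⟩, cornerSub_ext ?_⟩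
      · show (1 - e) • (1 - e) • x = (1 - e) • x
        rw [smul_smul, he.out.one_sub]
      · show φ (d 0 ((1 - e) • x)) = y.1
        rw [map_smul, hx, map_smul, LinearEquiv.apply_symm_apply, hy]
    · refine cornerMap_exact (1 - e) _ _ ?_
      rw [hex 0, LinearEquiv.ker_comp]
    · intro i
      exact cornerMap_exact (1 - e) _ _ (hex (i + 1))
  exact HasProjectiveDimensionLT.subsingleton _ (n - 1 + 1) k (by omega) N
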